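/- Let a, b be natural numbers. For every path w ∈ D_{a,b}, A(w) ≤ (2a+b)²/2 − a², and equality holds if and only if w is the path consisting of a+b up steps followed by a down steps. -/

import Mathlib

noncomputable section

open Finset

/-- Height of the path `w` (of length `L`, up = `true`, down = `false`) after `i` steps. -/
def height {L : ℕ} (w : Fin L → Bool) (i : ℕ) : ℤ :=
  ∑ j ∈ Finset.univ.filter (fun j : Fin L => (j : ℕ) < i),
    (if w j then (1 : ℤ) else -1)

/-- `DyckSet a b`: the set `D_{a,b}` of paths of length `2a+b` with `a+b` up steps whose
heights stay nonnegative. -/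
def DyckSet (a b : ℕ) : Finset (Fin (2 * a + b) → Bool) :=
  Finset.univ.filter (fun w =>
    (Finset.univ.filter (fun j => w j = true)).card = a + b ∧
      ∀ i ≤ 2 * a + b, 0 ≤ height w i)

/-- The area `A(w)` between the path `w` and the x-axis. -/
def area {L : ℕ} (w : Fin L → Bool) : ℝ :=
  (∑ i ∈ Finset.range L, ((height w i + height w (i + 1) : ℤ) : ℝ)) / 2

/-- The weighted path sum `M_{2a+b,b}(t) = Σ_{w ∈ D_{a,b}} t^{A(w)}`. -/
def M (a b : ℕ) (t : ℝ) : ℝ := ∑ w ∈ DyckSet a b, t ^ area w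

/-- `M_{ℓ,m}(t)` for `ℓ ≥ m` with `ℓ - m` even. -/
def Mlm (ℓ m : ℕ) (t : ℝ) : ℝ := M ((ℓ - m) / 2) m t

/-- `P k`: the number of partitions of `k`. -/
def P (k : ℕ) : ℕ := Fintype.card (Nat.Partition k)

/-- `C(t) = Σ_{k=0}^∞ P(k) t^{-2k}`. -/
def C (t : ℝ) : ℝ := ∑' k : ℕ, (P k : ℝ) * t ^ (-(2 : ℝ) * k)

lemma height_zero {L : ℕ} (w : Fin L → Bool) : height w 0 = 0 := by
  simp [height]

lemma height_succ {L : ℕ} (w : Fin L → Bool) (i : Fin L) :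
    height w (i + 1) = height w i + if w i then 1 else -1 := by
  have h : univ.filter (fun j : Fin L => (j : ℕ) < i + 1) =
      insert i (univ.filter (fun j : Fin L => (j : ℕ) < i)) := by
    ext j
    simp only [mem_filter, mem_univ, true_and, mem_insert, Fin.ext_iff]
    omega
  rw [height, h, sum_insert (by simp), add_comm, height]

lemma height_length {L : ℕ} (w : Fin L → Bool) :
    height w L = 2 * ((univ.filter (fun j => w j = true)).card : ℤ) - L := by
  have h : ∀ j, (if w j then (1 : ℤ) else -1) = 2 * (if w j then 1 else 0) - 1 := by
    intro j
    split_ifs <;> norm_num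
  simp [height, h, ← mul_sum, -mul_ite]

lemma abs_height_succ_sub_le {L : ℕ} (w : Fin L → Bool) {i : ℕ} (hi : i < L) :
    |height w (i + 1) - height w i| ≤ 1 := by
  rw [height_succ w ⟨i, hi⟩]
  split_ifs <;> simp

lemma height_le {L : ℕ} (w : Fin L → Bool) {i : ℕ} (hi : i ≤ L) : height w i ≤ i := by
  induction i with
  | zero => simp [height_zero]
  | succ i ih =>
    have := (abs_le.mp (abs_height_succ_sub_le w hi)).2
    have := ih (by omega)
    push_cast
    omega

lemma height_le_height_add {L : ℕ} (w : Fin L → Bool) (i k : ℕ) (h : i + k ≤ L) :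
    height w i ≤ height w (i + k) + k := by
  induction k with
  | zero => simp
  | succ k ih =>
    have := (abs_le.mp (abs_height_succ_sub_le w (i := i + k) (by omega))).1
    have := ih (by omega)
    rw [← add_assoc]
    push_cast
    omega

/-- The height after `i` steps of the path with `a + b` up steps followed by down steps. -/
def peakHeight (a b i : ℕ) : ℤ := min (i : ℤ) (2 * (a + b) - i)

lemma sum_peakHeight (a b : ℕ) :
    ∑ i ∈ range (2 * a + b), (peakHeight a b i + peakHeight a b (i + 1)) =
      ((2 * a + b : ℕ) : ℤ) ^ 2 - 2 * (a : ℤ) ^ 2 := by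
  have up : ∀ n ≤ a + b,
      ∑ i ∈ range n, (peakHeight a b i + peakHeight a b (i + 1)) = (n : ℤ) ^ 2 := by
    intro n hn
    induction n with
    | zero => simp
    | succ n ih =>
      have h₁ : peakHeight a b n = n := min_eq_left (by omega)
      have h₂ : peakHeight a b (n + 1) = n + 1 := by
        rw [peakHeight, min_eq_left (by push_cast; omega)]
        push_cast
        rfl
      rw [sum_range_succ, ih (by omega), h₁, h₂]
      push_cast
      ring
  have down : ∀ n : ℕ,
      ∑ i ∈ range n, (peakHeight a b (a + b + i) + peakHeight a b (a + b + i + 1)) =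
        2 * ((a : ℤ) + b) * n - (n : ℤ) ^ 2 := by
    intro n
    induction n with
    | zero => simp
    | succ n ih =>
      have h : ∀ m : ℕ, peakHeight a b (a + b + m) = a + b - m := by
        intro m
        rw [peakHeight, min_eq_right (by push_cast; omega)]
        push_cast
        ring
      rw [sum_range_succ, ih, h, add_assoc (a + b), h]
      push_cast
      ring
  rw [show 2 * a + b = a + b + a by ring, sum_range_add, up _ le_rfl, down]
  push_cast
  ring

lemma height_le_peakHeight {a b : ℕ} (w : Fin (2 * a + b) → Bool)
    (hw : (univ.filter (fun j => w j = true)).card = a + b) {i : ℕ} (hi : i ≤ 2 * a + b) :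
    height w i ≤ peakHeight a b i := by
  refine le_min (height_le w hi) ?_
  have h := height_le_height_add w i (2 * a + b - i) (by omega)
  rw [Nat.add_sub_cancel' hi, height_length, hw] at h
  push_cast [hi] at h
  omega

lemma height_eq_peakHeight_iff {a b : ℕ} (w : Fin (2 * a + b) → Bool) :
    (∀ i ≤ 2 * a + b, height w i = peakHeight a b i) ↔
      w = fun j : Fin (2 * a + b) => decide ((j : ℕ) < a + b) := by
  constructor
  · intro h
    ext j
    have hj := height_succ w j
    rw [h _ j.isLt.le, h _ j.isLt] at hj
    unfold peakHeight at hj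
    cases hwj : w j <;> simp [hwj] at hj ⊢ <;> omega
  · rintro rfl i hi
    induction i with
    | zero => simp [height_zero, peakHeight]; omega
    | succ i ih =>
      rw [height_succ _ ⟨i, hi⟩, ih (by omega)]
      unfold peakHeight
      by_cases h : i < a + b <;> simp [h] <;> omega

lemma area_eq_intCast {L : ℕ} (w : Fin L → Bool) :
    area w = ((∑ i ∈ range L, (height w i + height w (i + 1)) : ℤ) : ℝ) / 2 := by
  rw [area, Int.cast_sum]

/-- Maximal area: every `w ∈ D_{a,b}` has `A(w) ≤ (2a+b)²/2 - a²`, with equality iff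
`w` consists of `a+b` up steps followed by `a` down steps. -/
theorem stmt_3 (a b : ℕ) (w : Fin (2 * a + b) → Bool) (hw : w ∈ DyckSet a b) :
    area w ≤ ((2 * a + b : ℕ) : ℝ) ^ 2 / 2 - (a : ℝ) ^ 2 ∧
    (area w = ((2 * a + b : ℕ) : ℝ) ^ 2 / 2 - (a : ℝ) ^ 2 ↔
      w = fun j : Fin (2 * a + b) => decide ((j : ℕ) < a + b)) := by
  have hcard := (mem_filter.mp hw).2.1
  have hle : ∀ i ≤ 2 * a + b, height w i ≤ peakHeight a b i :=
    fun i hi => height_le_peakHeight w hcard hi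
  have hterm : ∀ i ∈ range (2 * a + b), height w i + height w (i + 1) ≤
      peakHeight a b i + peakHeight a b (i + 1) := fun i hi =>
    add_le_add (hle i (mem_range.mp hi).le) (hle (i + 1) (mem_range.mp hi))
  have hmax : ((2 * a + b : ℕ) : ℝ) ^ 2 / 2 - (a : ℝ) ^ 2 =
      ((∑ i ∈ range (2 * a + b), (peakHeight a b i + peakHeight a b (i + 1)) : ℤ) : ℝ) / 2 := by
    rw [sum_peakHeight]
    push_cast
    ring
  rw [area_eq_intCast, hmax, div_le_div_iff_of_pos_right two_pos, Int.cast_le,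
    div_left_inj' two_ne_zero, Int.cast_inj, sum_eq_sum_iff_of_le hterm,
    ← height_eq_peakHeight_iff]
  refine ⟨sum_le_sum hterm, fun h i hi => ?_, fun h i hi => ?_⟩
  · rcases i with _ | i
    · simp [height_zero, peakHeight]
      omega
    · have := h i (mem_range.mpr hi)
      have := hle i (by omega)
      have := hle (i + 1) hi
      omega
  · rw [h i (mem_range.mp hi).le, h (i + 1) (mem_range.mp hi)]
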